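/- Let Λ = D4 ⊕ A1 be the orthogonal direct sum of the D4 lattice ({x ∈ ℤ^4 : Σxᵢ even}, B(x,y) = −(x·y)) and the rank-one lattice ℤ with B(a,b) = −2ab. Then: (i) exactly 16 classes in Λ/2Λ satisfy q₀ = 1; (ii) exactly 3 of these classes lie in R₁; (iii) the remaining 13 classes are exactly the classes containing a root (an element e with B(e,e) = −2); that is, a class with q₀ = 1 contains a root if and only if it does not lie in R₁. -/

import Mathlib

open Matrix

/-- The D_n lattice: integer vectors with even coordinate sum. -/
def Dn (n : ℕ) : Submodule ℤ (Fin n → ℤ) where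
  carrier := {x | (2 : ℤ) ∣ ∑ i, x i}
  add_mem' := by
    intro a b ha hb
    simpa [Finset.sum_add_distrib] using dvd_add ha hb
  zero_mem' := by simp
  smul_mem' := by
    intro c x hx
    simpa [smul_eq_mul, ← Finset.mul_sum] using hx.mul_left c

/-- The lattice `D4 ⊕ A1` as a ℤ-module: the orthogonal direct sum of `D4` and
the rank-one lattice `ℤ`. -/
abbrev D4A1 : Type := (Dn 4) × ℤ

/-- The bilinear form of `D4 ⊕ A1`: the form `-(x·y)` on the `D4` summand and
`-2ab` on the `A1` summand. -/
def DAform (x y : D4A1) : ℤ :=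
  -((x.1 : Fin 4 → ℤ) ⬝ᵥ (y.1 : Fin 4 → ℤ)) + -(2 * x.2 * y.2)

/-- The submodule `2Λ ⊆ Λ`. -/
def twoSub (M : Type*) [AddCommGroup M] [Module ℤ M] : Submodule ℤ M :=
  LinearMap.range ((2 : ℤ) • (LinearMap.id : M →ₗ[ℤ] M))

/-- The quotient `Λ/2Λ` for `D4 ⊕ A1`. -/
abbrev VDA : Type := D4A1 ⧸ twoSub D4A1

/-- `q₀(c) = 1`: the class `c` has a representative `v` with `B v v / 2` odd. -/
def q0one (c : VDA) : Prop :=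
  ∃ v : D4A1, Submodule.Quotient.mk v = c ∧ (DAform v v / 2) % 2 = 1

/-- `c ∈ R₁`: `c` lies in the radical and `q(c) = 1 ∈ ℤ/4`. -/
def inR1 (c : VDA) : Prop :=
  ∃ v : D4A1, Submodule.Quotient.mk v = c ∧
    (∀ w : D4A1, (2 : ℤ) ∣ DAform v w) ∧ (DAform v v / 2) % 4 = 1

/-- `c` contains a root, i.e. a representative `e` with `B e e = -2`. -/
def hasRoot (c : VDA) : Prop :=
  ∃ e : D4A1, Submodule.Quotient.mk e = c ∧ DAform e e = -2

/-- The element of `D4 ⊕ A1` with coordinates `x, y, z, h, a`, where `2h` is the coordinate sum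
of the `D4` component. -/
def ofCoords (x y z h a : ℤ) : D4A1 :=
  (⟨![x, y, z, 2 * h - x - y - z], by
    change (2 : ℤ) ∣ _
    simp only [Fin.sum_univ_four]
    exact ⟨h, by simp⟩⟩, a)

lemma exists_ofCoords (v : D4A1) : ∃ x y z h a, v = ofCoords x y z h a := by
  obtain ⟨⟨f, hf⟩, a⟩ := v
  obtain ⟨h, hh⟩ : (2 : ℤ) ∣ ∑ i, f i := hf
  rw [Fin.sum_univ_four] at hh
  refine ⟨f 0, f 1, f 2, h, a, Prod.ext (Subtype.ext ?_) rfl⟩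
  funext i
  fin_cases i <;> simp [ofCoords]
  linarith

lemma DAform_ofCoords (x y z h a x' y' z' h' a' : ℤ) :
    DAform (ofCoords x y z h a) (ofCoords x' y' z' h' a') =
      -(x * x' + y * y' + z * z' + (2 * h - x - y - z) * (2 * h' - x' - y' - z')) -
        2 * a * a' := by
  simp [DAform, ofCoords, dotProduct, Fin.sum_univ_four]
  ring

/-- Half of the quadratic form of `D4 ⊕ A1` in coordinates, over any commutative ring. -/
def halfForm {S : Type*} [CommRing S] (x y z h a : S) : S :=
  -(x * x + y * y + z * z + x * y + x * z + y * z + 2 * h * h - 2 * h * (x + y + z)) - a * a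

lemma DAform_ofCoords_self (x y z h a : ℤ) :
    DAform (ofCoords x y z h a) (ofCoords x y z h a) = 2 * halfForm x y z h a := by
  rw [DAform_ofCoords, halfForm]
  ring

lemma half_DAform_ofCoords (x y z h a : ℤ) :
    DAform (ofCoords x y z h a) (ofCoords x y z h a) / 2 = halfForm x y z h a := by
  rw [DAform_ofCoords_self]
  omega

lemma cast_halfForm {S : Type*} [CommRing S] (x y z h a : ℤ) :
    ((halfForm x y z h a : ℤ) : S) = halfForm (x : S) y z h a := by
  simp [halfForm]

/-- Coordinates modulo two. -/
abbrev Coords2 : Type := ZMod 2 × ZMod 2 × ZMod 2 × ZMod 2 × ZMod 2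

/-- Reduction of the coordinates of `D4 ⊕ A1` modulo two. -/
def reduceCoords : D4A1 →ₗ[ℤ] Coords2 :=
  AddMonoidHom.toIntLinearMap <| AddMonoidHom.mk'
    (fun v => (((v.1 : Fin 4 → ℤ) 0 : ZMod 2), ((v.1 : Fin 4 → ℤ) 1 : ZMod 2),
      ((v.1 : Fin 4 → ℤ) 2 : ZMod 2), (((∑ i, (v.1 : Fin 4 → ℤ) i) / 2 : ℤ) : ZMod 2),
      (v.2 : ZMod 2)))
    (by
      rintro ⟨⟨f, hf⟩, a⟩ ⟨⟨g, hg⟩, b⟩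
      have hf' : (2 : ℤ) ∣ ∑ i, f i := hf
      simp [Finset.sum_add_distrib, Int.add_ediv_of_dvd_left hf'])

lemma reduceCoords_ofCoords (x y z h a : ℤ) :
    reduceCoords (ofCoords x y z h a) = ((x : ZMod 2), (y : ZMod 2), (z : ZMod 2),
      (h : ZMod 2), (a : ZMod 2)) := by
  simp [reduceCoords, ofCoords, Fin.sum_univ_four]

lemma reduceCoords_surjective : Function.Surjective reduceCoords := by
  rintro ⟨x, y, z, h, a⟩
  refine ⟨ofCoords x.cast y.cast z.cast h.cast a.cast, ?_⟩
  simp [reduceCoords_ofCoords]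

lemma ker_reduceCoords : LinearMap.ker reduceCoords = twoSub D4A1 := by
  ext v
  rw [LinearMap.mem_ker, twoSub, LinearMap.mem_range]
  constructor
  · obtain ⟨x, y, z, h, a, rfl⟩ := exists_ofCoords v
    intro hv
    simp only [reduceCoords_ofCoords, Prod.mk_eq_zero, ZMod.intCast_zmod_eq_zero_iff_dvd] at hv
    obtain ⟨⟨x, rfl⟩, ⟨y, rfl⟩, ⟨z, rfl⟩, ⟨h, rfl⟩, ⟨a, rfl⟩⟩ := hv
    refine ⟨ofCoords x y z h a, Prod.ext (Subtype.ext ?_) ?_⟩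
    · funext i
      fin_cases i <;> simp [ofCoords]
      ring
    · simp [ofCoords]
  · rintro ⟨w, rfl⟩
    rw [LinearMap.smul_apply, LinearMap.id_apply, map_smul]
    generalize reduceCoords w = t
    revert t
    decide

/-- The identification of `Λ/2Λ` with coordinate vectors modulo two. -/
noncomputable def classEquiv : VDA ≃ Coords2 :=
  ((Submodule.quotEquivOfEq _ _ ker_reduceCoords.symm).trans
    (reduceCoords.quotKerEquivOfSurjective reduceCoords_surjective)).toEquiv

lemma classEquiv_mk (v : D4A1) :
    classEquiv (Submodule.Quotient.mk v) = reduceCoords v := rfl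

/-- The condition `q₀ = 1` in coordinates. -/
def IsOddCoords (t : Coords2) : Prop :=
  halfForm t.1 t.2.1 t.2.2.1 t.2.2.2.1 t.2.2.2.2 = 1

/-- The condition of lying in `R₁`, in coordinates. -/
def IsR1Coords (t : Coords2) : Prop :=
  t.1 = t.2.1 ∧ t.2.1 = t.2.2.1 ∧ (t.1 ≠ 0 ∨ t.2.2.2.1 ≠ 0) ∧ t.2.2.2.2 = 1

instance : DecidablePred IsOddCoords := fun t => by unfold IsOddCoords; infer_instance

instance : DecidablePred IsR1Coords := fun t => by unfold IsR1Coords; infer_instance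

lemma half_DAform_odd_iff (v : D4A1) :
    (DAform v v / 2) % 2 = 1 ↔ IsOddCoords (reduceCoords v) := by
  obtain ⟨x, y, z, h, a, rfl⟩ := exists_ofCoords v
  rw [half_DAform_ofCoords, reduceCoords_ofCoords, IsOddCoords, ← cast_halfForm,
    ← Int.odd_iff, ZMod.intCast_eq_one_iff_odd]

lemma q0one_iff (c : VDA) : q0one c ↔ IsOddCoords (classEquiv c) := by
  constructor
  · rintro ⟨v, rfl, hv⟩
    exact (half_DAform_odd_iff v).1 hv
  · intro hc
    obtain ⟨v, rfl⟩ := Submodule.Quotient.mk_surjective _ c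
    exact ⟨v, rfl, (half_DAform_odd_iff v).2 hc⟩

lemma forall_two_dvd_DAform_iff (x y z h a : ℤ) :
    (∀ w, (2 : ℤ) ∣ DAform (ofCoords x y z h a) w) ↔ (2 : ℤ) ∣ x - y ∧ (2 : ℤ) ∣ y - z := by
  constructor
  · intro hw
    have h₁ := hw (ofCoords 1 (-1) 0 0 0)
    have h₂ := hw (ofCoords 0 1 (-1) 0 0)
    rw [DAform_ofCoords] at h₁ h₂
    constructor <;> omega
  · rintro ⟨⟨k, hk⟩, ⟨l, hl⟩⟩ w
    obtain ⟨x', y', z', h', a', rfl⟩ := exists_ofCoords w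
    rw [DAform_ofCoords]
    obtain rfl : y = z + 2 * l := by linarith
    obtain rfl : x = z + 2 * l + 2 * k := by linarith
    exact ⟨-((l + k) * x' + l * y' + (h - 2 * z - 2 * l - k) * (2 * h' - x' - y' - z') + z * h' +
      a * a'), by ring⟩

lemma halfForm_zmod_four : ∀ x y z h a : ZMod 4, 2 * (x - y) = 0 → 2 * (y - z) = 0 →
    (halfForm x y z h a = 1 ↔ (¬ 2 * x = 0 ∨ ¬ 2 * h = 0) ∧ ¬ 2 * a = 0) := by
  unfold halfForm
  decide +kernel

lemma halfForm_emod_four_eq_one_iff (x y z h a : ℤ) (hxy : (2 : ℤ) ∣ x - y)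
    (hyz : (2 : ℤ) ∣ y - z) :
    halfForm x y z h a % 4 = 1 ↔ (¬ (2 : ℤ) ∣ x ∨ ¬ (2 : ℤ) ∣ h) ∧ ¬ (2 : ℤ) ∣ a := by
  have hdvd (n : ℤ) : (2 : ℤ) ∣ n ↔ 2 * (n : ZMod 4) = 0 := by
    have := ZMod.intCast_zmod_eq_zero_iff_dvd (2 * n) 4
    push_cast at this
    rw [this]
    omega
  have hone (n : ℤ) : n % 4 = 1 ↔ (n : ZMod 4) = 1 := by
    have := ZMod.intCast_eq_intCast_iff' n 1 4
    push_cast at this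
    rw [this]
  rw [hdvd] at hxy hyz
  rw [hone, hdvd, hdvd, hdvd, cast_halfForm]
  push_cast at hxy hyz
  exact halfForm_zmod_four _ _ _ _ _ hxy hyz

lemma radical_iff_isR1Coords (v : D4A1) :
    ((∀ w, (2 : ℤ) ∣ DAform v w) ∧ (DAform v v / 2) % 4 = 1) ↔ IsR1Coords (reduceCoords v) := by
  obtain ⟨x, y, z, h, a, rfl⟩ := exists_ofCoords v
  have ha : (a : ZMod 2) = 1 ↔ ¬ (2 : ℤ) ∣ a := by
    rw [ZMod.intCast_eq_one_iff_odd, ← Int.not_even_iff_odd, even_iff_two_dvd]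
  have hsub (m n : ℤ) : (m : ZMod 2) = n ↔ (2 : ℤ) ∣ m - n := by
    rw [← sub_eq_zero, ← Int.cast_sub, ZMod.intCast_zmod_eq_zero_iff_dvd]; rfl
  have hzero (m : ℤ) : (m : ZMod 2) = 0 ↔ (2 : ℤ) ∣ m :=
    ZMod.intCast_zmod_eq_zero_iff_dvd m 2
  rw [forall_two_dvd_DAform_iff, half_DAform_ofCoords, reduceCoords_ofCoords]
  simp only [IsR1Coords, ha, hsub, ne_eq, hzero]
  constructor
  · rintro ⟨⟨hxy, hyz⟩, hq⟩
    exact ⟨hxy, hyz, (halfForm_emod_four_eq_one_iff x y z h a hxy hyz).1 hq⟩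
  · rintro ⟨hxy, hyz, hq⟩
    exact ⟨⟨hxy, hyz⟩, (halfForm_emod_four_eq_one_iff x y z h a hxy hyz).2 hq⟩

lemma inR1_iff (c : VDA) : inR1 c ↔ IsR1Coords (classEquiv c) := by
  constructor
  · rintro ⟨v, rfl, hv⟩
    exact (radical_iff_isR1Coords v).1 hv
  · intro hc
    obtain ⟨v, rfl⟩ := Submodule.Quotient.mk_surjective _ c
    exact ⟨v, rfl, (radical_iff_isR1Coords v).2 hc⟩

lemma q0one_of_hasRoot {c : VDA} (hc : hasRoot c) : q0one c := by
  obtain ⟨e, rfl, he⟩ := hc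
  exact ⟨e, rfl, by rw [he]; rfl⟩

lemma not_inR1_of_hasRoot {c : VDA} (hc : hasRoot c) : ¬ inR1 c := by
  obtain ⟨e, rfl, he⟩ := hc
  rw [inR1_iff, classEquiv_mk, ← radical_iff_isR1Coords, he]
  rintro ⟨-, h⟩
  norm_num at h

lemma exists_root_coords : ∀ t : Coords2, IsOddCoords t → ¬ IsR1Coords t →
    ∃ x ∈ Finset.Icc (-1 : ℤ) 1, ∃ y ∈ Finset.Icc (-1 : ℤ) 1, ∃ z ∈ Finset.Icc (-1 : ℤ) 1,
    ∃ h ∈ Finset.Icc (0 : ℤ) 1, ∃ a ∈ Finset.Icc (0 : ℤ) 1,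
      halfForm x y z h a = -1 ∧
        ((x : ZMod 2), (y : ZMod 2), (z : ZMod 2), (h : ZMod 2), (a : ZMod 2)) = t := by
  decide +kernel

lemma hasRoot_iff (c : VDA) : hasRoot c ↔ q0one c ∧ ¬ inR1 c := by
  refine ⟨fun hc => ⟨q0one_of_hasRoot hc, not_inR1_of_hasRoot hc⟩, ?_⟩
  rw [q0one_iff, inR1_iff]
  rintro ⟨h₀, h₁⟩
  obtain ⟨x, -, y, -, z, -, h, -, a, -, hq, ht⟩ := exists_root_coords _ h₀ h₁
  refine ⟨ofCoords x y z h a, classEquiv.injective ?_, ?_⟩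
  · rw [classEquiv_mk, reduceCoords_ofCoords, ht]
  · rw [DAform_ofCoords_self, hq]
    rfl

/-- Classes are counted by their coordinates. -/
lemma card_classes {p : VDA → Prop} {P : Coords2 → Prop} [DecidablePred P]
    (hp : ∀ c, p c ↔ P (classEquiv c)) :
    Nat.card {c : VDA // p c} = (Finset.univ.filter P).card := by
  rw [Nat.card_congr (classEquiv.subtypeEquiv hp), Nat.card_eq_fintype_card,
    Fintype.card_subtype]

/-- For the lattice `D4 ⊕ A1`: (i) exactly 16 classes of `Λ/2Λ`
satisfy `q₀ = 1`; (ii) exactly 3 of them lie in `R₁`; (iii) the remaining 13 are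
exactly the classes containing a root: a class with `q₀ = 1` contains a root iff
it does not lie in `R₁`. -/
theorem stmt_8 :
    Nat.card {c : VDA // q0one c} = 16 ∧
    Nat.card {c : VDA // q0one c ∧ inR1 c} = 3 ∧
    (∀ c : VDA, q0one c → (hasRoot c ↔ ¬ inR1 c)) ∧
    Nat.card {c : VDA // hasRoot c} = 13 := by
  refine ⟨?_, ?_, fun c hc => ?_, ?_⟩
  · rw [card_classes q0one_iff]
    decide +kernel
  · rw [card_classes (P := fun t => IsOddCoords t ∧ IsR1Coords t) fun c =>
      and_congr (q0one_iff c) (inR1_iff c)]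
    decide +kernel
  · rw [hasRoot_iff, and_iff_right hc]
  · rw [card_classes (P := fun t => IsOddCoords t ∧ ¬ IsR1Coords t) fun c => (hasRoot_iff c).trans
      (and_congr (q0one_iff c) (not_congr (inR1_iff c)))]
    decide +kernel
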